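/- arXiv:2401.15837 — 3 statements merged into one kernel-verified Lean document; each statement's English description precedes it below -/
import Mathlib

section
/- Let f be a real polynomial in x_1,…,x_n of degree d with f(x) > 0 for all x ∈ ℝⁿ, whose highest-degree homogeneous part f^(∞) is positive definite (f^(∞)(x) > 0 for all x ≠ 0), and which admits a csp (x(1),…,x(p)) satisfying the RIP. Then for every ε > 0 there exist, for each ℓ ∈ {1,…,p}, a sum of squares σ_ℓ ∈ Σ[{x_0} ∪ x(ℓ) ∪ {w_ℓ}] and a polynomial τ_ℓ ∈ ℝ[{x_0} ∪ x(ℓ) ∪ {w_ℓ}] such that f̃ + ε·Σ_{ℓ=1}^p w_ℓ^d = Σ_{ℓ=1}^p ( σ_ℓ + τ_ℓ·(x_0² + Σ_{x_i∈x(ℓ)} x_i² + w_ℓ² − 1) ) as polynomials in x_0,x_1,…,x_n,w_1,…,w_p. -/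
open MvPolynomial

/-- `q` is a sum of squares of polynomials using only the variables in `A`. -/
def IsSOSOn {σ : Type*} [DecidableEq σ] (A : Finset σ) (q : MvPolynomial σ ℝ) : Prop :=
  ∃ (t : ℕ) (h : Fin t → MvPolynomial σ ℝ),
    (∀ i, (h i).vars ⊆ A) ∧ q = ∑ i, (h i) ^ 2

section ArchimedeanPreordering

variable {R : Type*} [CommRing R]

/-- The preordering generated by a preordering `T` and an element `a`. -/
def Subsemiring.adjoinPos (T : Subsemiring R) (hT : ∀ x, x * x ∈ T) (a : R) : Subsemiring R where
  carrier := {x | ∃ s ∈ T, ∃ t ∈ T, x = s + a * t}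
  zero_mem' := ⟨0, T.zero_mem, 0, T.zero_mem, by ring⟩
  one_mem' := ⟨1, T.one_mem, 0, T.zero_mem, by ring⟩
  add_mem' := by
    rintro _ _ ⟨s, hs, t, ht, rfl⟩ ⟨s', hs', t', ht', rfl⟩
    exact ⟨s + s', add_mem hs hs', t + t', add_mem ht ht', by ring⟩
  mul_mem' := by
    rintro _ _ ⟨s, hs, t, ht, rfl⟩ ⟨s', hs', t', ht', rfl⟩
    exact ⟨s * s' + a * a * (t * t'), add_mem (mul_mem hs hs') (mul_mem (hT a) (mul_mem ht ht')),
      s * t' + t * s', add_mem (mul_mem hs ht') (mul_mem ht hs'), by ring⟩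

theorem Subsemiring.le_adjoinPos (T : Subsemiring R) (hT : ∀ x, x * x ∈ T) (a : R) :
    T ≤ T.adjoinPos hT a :=
  fun s hs => ⟨s, hs, 0, T.zero_mem, by ring⟩

theorem Subsemiring.mem_adjoinPos_self (T : Subsemiring R) (hT : ∀ x, x * x ∈ T) (a : R) :
    a ∈ T.adjoinPos hT a :=
  ⟨0, T.zero_mem, 1, T.one_mem, by ring⟩

/-- A proper preordering is contained in one that contains `a` or `-a` for each `a`. -/
theorem Subsemiring.exists_le_total (T : Subsemiring R) (hT : ∀ x, x * x ∈ T)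
    (hneg : (-1 : R) ∉ T) :
    ∃ P : Subsemiring R, T ≤ P ∧ (-1 : R) ∉ P ∧ ∀ a, a ∈ P ∨ -a ∈ P := by
  obtain ⟨P, hTP, hP⟩ := zorn_le_nonempty₀ {S : Subsemiring R | (-1 : R) ∉ S} (by
    intro c hc hchain y hy
    refine ⟨sSup c, ?_, fun z hz => le_sSup hz⟩
    change (-1 : R) ∉ sSup c
    rw [Subsemiring.mem_sSup_of_directedOn ⟨y, hy⟩ hchain.directedOn]
    rintro ⟨s, hs, h⟩
    exact hc hs h) T hneg
  have hsq : ∀ x, x * x ∈ P := fun x => hTP (hT x)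
  have hP1 : (-1 : R) ∉ P := hP.prop
  refine ⟨P, hTP, hP1, fun a => ?_⟩
  have key : ∀ b, b ∉ P → (-1 : R) ∈ P.adjoinPos hsq b := by
    intro b hb
    by_contra h
    exact hb (hP.le_of_ge (y := P.adjoinPos hsq b) h (P.le_adjoinPos hsq b)
      (P.mem_adjoinPos_self hsq b))
  by_contra! h
  obtain ⟨s, hs, t, ht, h1⟩ := key a h.1
  obtain ⟨s', hs', t', ht', h2⟩ := key (-a) h.2
  refine hP1 ?_
  have : (-1 : R) = s + s' + s * s' + a * a * (t * t') := by
    linear_combination (s' + 1) * h1 - a * t * h2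
  rw [this]
  exact add_mem (add_mem (add_mem hs hs') (mul_mem hs hs')) (mul_mem (hsq a) (mul_mem ht ht'))

variable [Algebra ℝ R]

theorem Subsemiring.algebraMap_mem_of_nonneg {P : Subsemiring R} (hsq : ∀ x, x * x ∈ P) {c : ℝ}
    (hc : 0 ≤ c) : algebraMap ℝ R c ∈ P := by
  have := hsq (algebraMap ℝ R (√c))
  rwa [← map_mul, Real.mul_self_sqrt hc] at this

theorem Subsemiring.nonneg_of_algebraMap_mem {P : Subsemiring R} (hsq : ∀ x, x * x ∈ P)
    (hneg : (-1 : R) ∉ P) {c : ℝ} (hc : algebraMap ℝ R c ∈ P) : 0 ≤ c := by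
  by_contra! h
  refine hneg ?_
  have := mul_mem (algebraMap_mem_of_nonneg hsq (c := -c⁻¹) (by simpa using h.le)) hc
  rwa [← map_mul, neg_mul, inv_mul_cancel₀ h.ne, map_neg, map_one] at this

/-- The ideal of elements that are infinitesimal for an Archimedean preordering. -/
def Subsemiring.infinitesimals (P : Subsemiring R) (hsq : ∀ x, x * x ∈ P)
    (harch : ∀ a, ∃ N : ℝ, algebraMap ℝ R N - a ∈ P) : Ideal R where
  carrier := {x | ∀ δ : ℝ, 0 < δ → algebraMap ℝ R δ - x ∈ P ∧ algebraMap ℝ R δ + x ∈ P}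
  zero_mem' := fun δ hδ => by simpa using algebraMap_mem_of_nonneg hsq hδ.le
  add_mem' := by
    intro x y hx hy δ hδ
    have e : algebraMap ℝ R δ = algebraMap ℝ R (δ / 2) + algebraMap ℝ R (δ / 2) := by
      rw [← map_add]; congr 1; ring
    have h1 := hx (δ / 2) (half_pos hδ)
    have h2 := hy (δ / 2) (half_pos hδ)
    rw [e]
    constructor
    · convert add_mem h1.1 h2.1 using 1; ring
    · convert add_mem h1.2 h2.2 using 1; ring
  smul_mem' := by
    intro b x hx
    obtain ⟨N₁, h₁⟩ := harch b
    obtain ⟨N₂, h₂⟩ := harch (-b)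
    have hmono : ∀ (N M : ℝ) (a : R), N ≤ M → algebraMap ℝ R N - a ∈ P →
        algebraMap ℝ R M - a ∈ P := by
      intro N M a hNM h
      convert add_mem (algebraMap_mem_of_nonneg hsq (sub_nonneg.2 hNM)) h using 1
      rw [map_sub]; ring
    set N : ℝ := max 1 (max N₁ N₂)
    have hN : 0 < N := lt_of_lt_of_le one_pos (le_max_left _ _)
    have hb₁ := hmono N₁ N b ((le_max_left _ _).trans (le_max_right _ _)) h₁
    have hb₂ := hmono N₂ N (-b) ((le_max_right _ _).trans (le_max_right _ _)) h₂
    intro δ hδ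
    have hδN : algebraMap ℝ R δ = algebraMap ℝ R (1 / 2) * (2 * algebraMap ℝ R (δ / N)
        * algebraMap ℝ R N) := by
      rw [← map_ofNat (algebraMap ℝ R) 2, ← map_mul, ← map_mul, ← map_mul]
      congr 1; field_simp
    have hhalf : algebraMap ℝ R (1 / 2) * 2 = 1 := by
      rw [← map_ofNat (algebraMap ℝ R) 2, ← map_mul, ← map_one (algebraMap ℝ R)]
      congr 1; norm_num
    have hhalf_mem := algebraMap_mem_of_nonneg (P := P) hsq (c := 1 / 2) (by norm_num)
    obtain ⟨hx₁, hx₂⟩ := hx (δ / N) (div_pos hδ hN)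
    rw [smul_eq_mul, hδN]
    constructor
    · convert mul_mem hhalf_mem (add_mem (mul_mem hx₁ hb₂) (mul_mem hx₂ hb₁)) using 1
      linear_combination b * x * hhalf
    · convert mul_mem hhalf_mem (add_mem (mul_mem hx₁ hb₁) (mul_mem hx₂ hb₂)) using 1
      linear_combination -b * x * hhalf

/-- A total Archimedean proper preordering is nonnegative under some real character. -/
theorem Subsemiring.exists_algHom_of_total (P : Subsemiring R) (hsq : ∀ x, x * x ∈ P)
    (harch : ∀ a, ∃ N : ℝ, algebraMap ℝ R N - a ∈ P) (hneg : (-1 : R) ∉ P)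
    (htot : ∀ a, a ∈ P ∨ -a ∈ P) :
    ∃ φ : R →ₐ[ℝ] ℝ, ∀ t ∈ P, 0 ≤ φ t := by
  set J := P.infinitesimals hsq harch with hJ
  have hJmem : ∀ x, x ∈ J ↔
      ∀ δ : ℝ, 0 < δ → algebraMap ℝ R δ - x ∈ P ∧ algebraMap ℝ R δ + x ∈ P := fun x => Iff.rfl
  have hex : ∀ a, ∃ r : ℝ, a - algebraMap ℝ R r ∈ J := by
    intro a
    set Q : Set ℝ := {q | a - algebraMap ℝ R q ∈ P}
    obtain ⟨N₁, h₁⟩ := harch a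
    obtain ⟨N₂, h₂⟩ := harch (-a)
    have hQne : Q.Nonempty := ⟨-N₂, by
      change a - algebraMap ℝ R (-N₂) ∈ P
      convert h₂ using 1; rw [map_neg]; ring⟩
    have hQbdd : BddAbove Q := ⟨N₁, fun q hq => by
      have : algebraMap ℝ R (N₁ - q) ∈ P := by
        convert add_mem h₁ hq using 1; rw [map_sub]; ring
      linarith [nonneg_of_algebraMap_mem hsq hneg this]⟩
    refine ⟨sSup Q, (hJmem _).2 fun δ hδ => ⟨?_, ?_⟩⟩
    · rcases htot (a - algebraMap ℝ R (sSup Q + δ)) with h | h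
      · linarith [le_csSup hQbdd h]
      · convert h using 1; rw [map_add]; ring
    · obtain ⟨q, hq, hlt⟩ := exists_lt_of_lt_csSup hQne (sub_lt_self (sSup Q) hδ)
      have h0 := algebraMap_mem_of_nonneg (P := P) hsq (c := q - (sSup Q - δ)) (by linarith)
      convert add_mem hq h0 using 1
      simp only [map_sub]; ring
  have hconst : ∀ r : ℝ, algebraMap ℝ R r ∈ J → 0 ≤ r := by
    intro r hr
    refine le_of_forall_pos_le_add fun δ hδ => ?_
    have := ((hJmem _).1 hr δ hδ).2
    rw [← map_add] at this
    linarith [nonneg_of_algebraMap_mem hsq hneg this]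
  have hbij : Function.Bijective (Algebra.ofId ℝ (R ⧸ J)) := by
    constructor
    · rw [injective_iff_map_eq_zero]
      intro r hr
      have hr' : algebraMap ℝ R r ∈ J := Ideal.Quotient.eq_zero_iff_mem.1 hr
      refine le_antisymm ?_ (hconst r hr')
      have := hconst (-r) (by rw [map_neg]; exact J.neg_mem hr')
      linarith
    · intro x
      obtain ⟨a, rfl⟩ := Ideal.Quotient.mk_surjective x
      obtain ⟨r, hr⟩ := hex a
      exact ⟨r, ((Ideal.Quotient.mk_eq_mk_iff_sub_mem _ _).2 hr).symm⟩
  set e := AlgEquiv.ofBijective (Algebra.ofId ℝ (R ⧸ J)) hbij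
  refine ⟨(e.symm : (R ⧸ J) →ₐ[ℝ] ℝ).comp (Ideal.Quotient.mkₐ ℝ J), fun t ht => ?_⟩
  obtain ⟨r, hr⟩ := hex t
  have hφ : (e.symm : (R ⧸ J) →ₐ[ℝ] ℝ).comp (Ideal.Quotient.mkₐ ℝ J) t = r := by
    change e.symm (Ideal.Quotient.mk J t) = r
    rw [AlgEquiv.symm_apply_eq]
    exact (Ideal.Quotient.mk_eq_mk_iff_sub_mem _ _).2 hr
  rw [hφ]
  refine le_of_forall_pos_le_add fun δ hδ => ?_
  have : algebraMap ℝ R (r + δ) ∈ P := by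
    convert add_mem ht ((hJmem _).1 hr δ hδ).1 using 1; rw [map_add]; ring
  exact nonneg_of_algebraMap_mem hsq hneg this

/-- The Archimedean Positivstellensatz for preorderings. -/
theorem Subsemiring.mem_of_forall_algHom_pos (T : Subsemiring R) (hsq : ∀ x, x * x ∈ T)
    (harch : ∀ a, ∃ N : ℝ, algebraMap ℝ R N - a ∈ T) (f : R)
    (hf : ∀ φ : R →ₐ[ℝ] ℝ, (∀ t ∈ T, 0 ≤ φ t) → 0 < φ f) : f ∈ T := by
  obtain ⟨s, hs, t, ht, hst⟩ : (-1 : R) ∈ T.adjoinPos hsq (-f) := by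
    by_contra hneg
    obtain ⟨P, hTP, hP1, htot⟩ := (T.adjoinPos hsq (-f)).exists_le_total
      (fun x => T.le_adjoinPos hsq _ (hsq x)) hneg
    have hle : T ≤ P := (T.le_adjoinPos hsq _).trans hTP
    obtain ⟨φ, hφ⟩ := P.exists_algHom_of_total (fun x => hle (hsq x))
      (fun a => (harch a).imp fun N h => hle h) hP1 htot
    have h1 := hφ _ (hTP (T.mem_adjoinPos_self hsq (-f)))
    have h2 := hf φ fun t ht => hφ t (hle ht)
    rw [map_neg] at h1
    linarith
  have hmono : ∀ (N M : ℝ) (a : R), N ≤ M → algebraMap ℝ R N - a ∈ T →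
      algebraMap ℝ R M - a ∈ T := by
    intro N M a hNM h
    convert add_mem (algebraMap_mem_of_nonneg hsq (sub_nonneg.2 hNM)) h using 1
    rw [map_sub]; ring
  obtain ⟨N₁, h₁⟩ := harch t
  obtain ⟨N₂, h₂⟩ := harch (1 + t * t * f)
  obtain ⟨N₃, h₃⟩ := harch (-f)
  set k : ℝ := max 1 (max N₁ N₂) with hk
  have hk1 : 1 ≤ k := le_max_left _ _
  have hN₁ : N₁ ≤ k := (le_max_left _ _).trans (le_max_right _ _)
  have hN₂ : N₂ ≤ k := (le_max_right _ _).trans (le_max_right _ _)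
  have hkt : algebraMap ℝ R (2 * k) - t ∈ T := hmono _ _ _ (by linarith) h₁
  have hkf : algebraMap ℝ R (2 * k) - (1 + t * t * f) ∈ T := hmono _ _ _ (by linarith) h₂
  have hk0 : 0 < k := by linarith
  have step : ∀ r : ℝ, 0 ≤ r → f + algebraMap ℝ R r ∈ T →
      f + algebraMap ℝ R (r - (k * k)⁻¹) ∈ T := by
    intro r hr h
    set κ := algebraMap ℝ R k with hκ
    set ρ := algebraMap ℝ R r with hρ
    have h2k : algebraMap ℝ R (2 * k) = 2 * κ := by rw [map_mul, map_ofNat]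
    rw [h2k] at hkt hkf
    have hκm : κ ∈ T := algebraMap_mem_of_nonneg hsq hk0.le
    have hρm : ρ ∈ T := algebraMap_mem_of_nonneg hsq hr
    have hκ2 : algebraMap ℝ R (k * k)⁻¹ ∈ T := algebraMap_mem_of_nonneg hsq (by positivity)
    have hinv : algebraMap ℝ R (k * k)⁻¹ * (κ * κ) = 1 := by
      rw [hκ, ← map_mul, ← map_mul, inv_mul_cancel₀ (by positivity), map_one]
    have hmem := add_mem (add_mem (add_mem (mul_mem (hsq (κ - t)) h)
      (mul_mem (add_mem hκm hκm) hs)) (mul_mem (mul_mem hρm ht) hkt)) hkf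
    convert mul_mem hκ2 hmem using 1
    rw [map_sub]
    linear_combination (-(f + ρ)) * hinv + algebraMap ℝ R (k * k)⁻¹ * (2 * κ) * hst
  have hiter : ∀ m : ℕ, ∃ r : ℝ, f + algebraMap ℝ R r ∈ T ∧
      (r < 0 ∨ r ≤ max N₃ 0 - m * (k * k)⁻¹) := by
    intro m
    induction m with
    | zero =>
      refine ⟨max N₃ 0, ?_, Or.inr (by simp)⟩
      have := hmono N₃ (max N₃ 0) (-f) (le_max_left _ _) h₃
      convert this using 1; ring
    | succ m ih =>
      obtain ⟨r, hr, h⟩ := ih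
      by_cases hr0 : r < 0
      · exact ⟨r, hr, Or.inl hr0⟩
      · refine ⟨_, step r (not_lt.1 hr0) hr, Or.inr ?_⟩
        have := h.resolve_left hr0
        push_cast
        linarith
  obtain ⟨m, hm⟩ := exists_nat_gt (max N₃ 0 * (k * k))
  obtain ⟨r, hr, h⟩ := hiter m
  have hr0 : r ≤ 0 := by
    rcases h with h | h
    · exact h.le
    · have : max N₃ 0 < m * (k * k)⁻¹ := by
        rw [← div_eq_mul_inv, lt_div_iff₀ (by positivity)]; exact hm
      linarith
  convert add_mem hr (algebraMap_mem_of_nonneg hsq (neg_nonneg.2 hr0)) using 1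
  rw [map_neg]; ring

end ArchimedeanPreordering

section Sphere

variable {ι : Type*} [Fintype ι]

/-- The preordering of polynomials that are sums of squares modulo the ideal generated by `g`. -/
def sumSqModulo {R : Type*} [CommRing R] (g : R) : Subsemiring R where
  carrier := {q | ∃ s, IsSumSq s ∧ ∃ τ, q = s + τ * g}
  zero_mem' := ⟨0, .zero, 0, by ring⟩
  one_mem' := ⟨1, .one, 0, by ring⟩
  add_mem' := by
    rintro _ _ ⟨s, hs, τ, rfl⟩ ⟨s', hs', τ', rfl⟩
    exact ⟨s + s', hs.add hs', τ + τ', by ring⟩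
  mul_mem' := by
    rintro _ _ ⟨s, hs, τ, rfl⟩ ⟨s', hs', τ', rfl⟩
    exact ⟨s * s', hs.mul hs', s * τ' + τ * s' + τ * τ' * g, by ring⟩

theorem sumSqModulo.mul_self_mem {R : Type*} [CommRing R] (g x : R) : x * x ∈ sumSqModulo g :=
  ⟨x * x, .mul_self x, 0, by ring⟩

theorem sumSqModulo.mul_generator_mem {R : Type*} [CommRing R] (g τ : R) :
    τ * g ∈ sumSqModulo g :=
  ⟨0, .zero, τ, by ring⟩

/-- The unit sphere makes its preordering Archimedean. -/
theorem sumSqModulo.archimedean_sphere (a : MvPolynomial ι ℝ) :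
    ∃ N : ℝ, algebraMap ℝ (MvPolynomial ι ℝ) N - a ∈
      sumSqModulo (∑ i, X i ^ 2 - 1 : MvPolynomial ι ℝ) := by
  classical
  set T := sumSqModulo (∑ i, X i ^ 2 - 1 : MvPolynomial ι ℝ) with hT
  have hsq : ∀ x, x * x ∈ T := sumSqModulo.mul_self_mem _
  suffices h : ∃ N : ℝ, C N - a ∈ T ∧ C N + a ∈ T from h.imp fun N h => h.1
  have hC : ∀ c : ℝ, 0 ≤ c → (C c : MvPolynomial ι ℝ) ∈ T := fun c hc =>
    Subsemiring.algebraMap_mem_of_nonneg hsq hc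
  have hhalf : (C (1 / 2) : MvPolynomial ι ℝ) * 2 = 1 := by
    rw [← map_ofNat (C : ℝ →+* MvPolynomial ι ℝ) 2, ← map_mul, ← C_1]
    congr 1; norm_num
  induction a using MvPolynomial.induction_on with
  | C r =>
    refine ⟨|r|, ?_, ?_⟩
    · rw [← map_sub]; exact hC _ (by linarith [le_abs_self r])
    · rw [← map_add]; exact hC _ (by linarith [neg_abs_le r])
  | add a b ha hb =>
    obtain ⟨N, h₁, h₂⟩ := ha
    obtain ⟨M, h₃, h₄⟩ := hb
    refine ⟨N + M, ?_, ?_⟩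
    · convert add_mem h₁ h₃ using 1; rw [map_add]; ring
    · convert add_mem h₂ h₄ using 1; rw [map_add]; ring
  | mul_X a i ha =>
    obtain ⟨N, h₁, h₂⟩ := ha
    have hX : (1 : MvPolynomial ι ℝ) - X i * X i ∈ T := by
      have h := add_mem (sum_mem (t := Finset.univ.erase i)
        (f := fun j => (X j * X j : MvPolynomial ι ℝ)) fun j _ => hsq (X j))
        (sumSqModulo.mul_generator_mem (∑ i, X i ^ 2 - 1 : MvPolynomial ι ℝ) (-1))
      convert h using 1
      rw [← Finset.add_sum_erase Finset.univ (fun j => (X j ^ 2 : MvPolynomial ι ℝ))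
        (Finset.mem_univ i)]
      simp only [pow_two]
      ring
    have h₃ : (1 : MvPolynomial ι ℝ) - X i ∈ T := by
      convert mul_mem (hC (1 / 2) (by norm_num)) (add_mem (hsq (1 - X i)) hX) using 1
      linear_combination (X i - 1) * hhalf
    have h₄ : (1 : MvPolynomial ι ℝ) + X i ∈ T := by
      convert mul_mem (hC (1 / 2) (by norm_num)) (add_mem (hsq (1 + X i)) hX) using 1
      linear_combination (-X i - 1) * hhalf
    refine ⟨N, ?_, ?_⟩
    · convert mul_mem (hC (1 / 2) (by norm_num)) (add_mem (mul_mem h₁ h₄) (mul_mem h₂ h₃)) using 1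
      linear_combination (a * X i - C N) * hhalf
    · convert mul_mem (hC (1 / 2) (by norm_num)) (add_mem (mul_mem h₁ h₃) (mul_mem h₂ h₄)) using 1
      linear_combination (-a * X i - C N) * hhalf

/-- Positive polynomials on the unit sphere are sums of squares modulo its equation. -/
theorem mem_sumSqModulo_of_pos_on_sphere (f : MvPolynomial ι ℝ)
    (hf : ∀ x : ι → ℝ, ∑ i, x i ^ 2 = 1 → 0 < eval x f) :
    f ∈ sumSqModulo (∑ i, X i ^ 2 - 1 : MvPolynomial ι ℝ) := by
  refine Subsemiring.mem_of_forall_algHom_pos _ (sumSqModulo.mul_self_mem _)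
    sumSqModulo.archimedean_sphere f fun φ hφ => ?_
  have he : ∀ q, φ q = eval (fun i => φ (X i)) q := by
    intro q
    refine (DFunLike.congr_fun (MvPolynomial.aeval_unique φ) q).trans ?_
    rw [← MvPolynomial.coe_aeval_eq_eval]
    rfl
  rw [he]
  refine hf _ ?_
  have h₁ := hφ _ (sumSqModulo.mul_generator_mem (∑ i, X i ^ 2 - 1 : MvPolynomial ι ℝ) 1)
  have h₂ := hφ _ (sumSqModulo.mul_generator_mem (∑ i, X i ^ 2 - 1 : MvPolynomial ι ℝ) (-1))
  simp only [map_mul, map_sub, map_sum, map_pow, map_neg, map_one] at h₁ h₂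
  linarith

theorem IsSumSq.isSOSOn_map {R σ : Type*} [CommRing R] [DecidableEq σ] {s : R} (hs : IsSumSq s)
    {A : Finset σ} (φ : R →+* MvPolynomial σ ℝ) (hφ : ∀ q, φ q ∈ supported ℝ (A : Set σ)) :
    IsSOSOn A (φ s) := by
  induction hs with
  | zero => exact ⟨0, Fin.elim0, fun i => i.elim0, by simp⟩
  | sq_add a hs ih =>
    obtain ⟨t, h, hv, he⟩ := ih
    refine ⟨t + 1, Fin.cons (φ a) h, fun i => ?_, ?_⟩
    · refine Fin.cases ?_ hv i
      exact_mod_cast mem_supported.1 (hφ a)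
    · simp [Fin.sum_univ_succ, he, pow_two]

/-- The sphere Positivstellensatz for polynomials that involve only the variables in `A`. -/
theorem exists_isSOSOn_of_pos_on_sphere {σ : Type*} [DecidableEq σ] (A : Finset σ)
    (g : MvPolynomial σ ℝ) (hg : g ∈ supported ℝ (A : Set σ))
    (hpos : ∀ z : σ → ℝ, (∀ i ∉ A, z i = 0) → ∑ i ∈ A, z i ^ 2 = 1 → 0 < eval z g) :
    ∃ s τ, IsSOSOn A s ∧ τ.vars ⊆ A ∧ g = s + τ * (∑ i ∈ A, X i ^ 2 - 1) := by
  have hren : ∀ q : MvPolynomial A ℝ,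
      rename (Subtype.val : A → σ) q ∈ supported ℝ (A : Set σ) := by
    intro q
    rw [supported_eq_range_rename]
    exact ⟨q, rfl⟩
  obtain ⟨q, rfl⟩ : ∃ q : MvPolynomial A ℝ, rename (Subtype.val : A → σ) q = g := by
    rw [supported_eq_range_rename] at hg
    exact hg
  obtain ⟨s, hs, τ, he⟩ := mem_sumSqModulo_of_pos_on_sphere q (by
    intro x hx
    have h := hpos (fun i => if h : i ∈ A then x ⟨i, h⟩ else 0) (fun i hi => by simp [hi]) (by
      rw [← Finset.sum_coe_sort A, ← hx]
      simp)
    rw [eval_rename] at h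
    convert h using 2
    congr 1
    ext i
    simp)
  refine ⟨rename Subtype.val s, rename Subtype.val τ,
    hs.isSOSOn_map (rename (R := ℝ) (Subtype.val : A → σ)).toRingHom hren,
    by exact_mod_cast mem_supported.1 (hren τ), ?_⟩
  rw [he, map_add, map_mul, map_sub, map_one, map_sum, ← Finset.sum_coe_sort A]
  simp

end Sphere

section Splitting

variable {V : Type*}

theorem MvPolynomial.eval_congr_of_mem_supported {s : Set V} {q : MvPolynomial V ℝ}
    (hq : q ∈ supported ℝ s) {x y : V → ℝ} (h : ∀ i ∈ s, x i = y i) : eval x q = eval y q :=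
  eval₂Hom_congr' rfl (fun i hi _ => h i (mem_supported.1 hq hi)) rfl

theorem isCompact_cube [Fintype V] : IsCompact {z : V → ℝ | ∀ i, |z i| ≤ 1} := by
  convert isCompact_univ_pi (fun _ : V => isCompact_Icc (a := (-1 : ℝ)) (b := 1)) using 1
  ext z
  simp [abs_le, Pi.le_def, forall_and]

theorem abs_le_one_of_sum_sq_eq_one {A : Finset V} {z : V → ℝ} (hz : ∑ i ∈ A, z i ^ 2 = 1) {i : V}
    (hi : i ∈ A) : |z i| ≤ 1 := by
  rw [← sq_le_one_iff_abs_le_one, ← hz]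
  exact Finset.single_le_sum (f := fun j => z j ^ 2) (fun j _ => sq_nonneg _) hi

/-- The minimum of a polynomial over the fibres of the projection of a sphere is continuous. -/
theorem exists_continuous_fiber_min [Fintype V] [DecidableEq V] {A U : Finset V} (hUA : U ⊆ A)
    {w : V} (hwA : w ∈ A) (hwU : w ∉ U) {G : MvPolynomial V ℝ}
    (hG : G ∈ supported ℝ (A : Set V)) :
    ∃ h : (V → ℝ) → ℝ, Continuous h ∧ (∀ y y', (∀ i ∈ U, y i = y' i) → h y = h y') ∧
      (∀ z, ∑ i ∈ A, z i ^ 2 = 1 → h z ≤ eval z G) ∧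
      ∀ y, ∑ i ∈ U, y i ^ 2 ≤ 1 → ∃ u : V → ℝ, (∀ i ∈ U, u i = y i) ∧ (∀ i ∉ A, u i = y i) ∧
        ∑ i ∈ A, u i ^ 2 = 1 ∧ eval u G = h y := by
  set K : Set (V → ℝ) := {v | (∀ i ∉ A \ U, v i = 0) ∧ ∑ i ∈ A \ U, v i ^ 2 = 1} with hK
  have hKcompact : IsCompact K := by
    refine isCompact_cube.of_isClosed_subset ?_ ?_
    · simp only [hK, Set.ofPred_and, Set.ofPred_forall]
      refine IsClosed.inter (isClosed_iInter fun i => isClosed_iInter fun _ => ?_) ?_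
      · exact isClosed_eq (continuous_apply i) continuous_const
      · exact isClosed_eq (by fun_prop) continuous_const
    · intro v hv i
      by_cases hi : i ∈ A \ U
      · exact abs_le_one_of_sum_sq_eq_one hv.2 hi
      · simp [hv.1 i hi]
  have hwK : (Pi.single w 1 : V → ℝ) ∈ K := by
    have hw : w ∈ A \ U := Finset.mem_sdiff.2 ⟨hwA, hwU⟩
    refine ⟨fun i hi => Pi.single_eq_of_ne (ne_of_mem_of_not_mem hw hi).symm _, ?_⟩
    rw [Finset.sum_eq_single_of_mem w hw fun i _ hi => by simp [Pi.single_eq_of_ne hi]]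
    simp
  set r : (V → ℝ) → ℝ := fun y => √(1 - ∑ i ∈ U, y i ^ 2) with hr
  set pt : (V → ℝ) → (V → ℝ) → V → ℝ := fun y v i =>
    if i ∈ U then y i else if i ∈ A then r y * v i else y i with hpt
  have hptc : Continuous fun q : (V → ℝ) × (V → ℝ) => pt q.1 q.2 := by
    refine continuous_pi fun i => ?_
    simp only [hpt]
    split_ifs
    · fun_prop
    · simp only [hr]; fun_prop
    · fun_prop
  have hevalc : Continuous fun q : (V → ℝ) × (V → ℝ) => eval (pt q.1 q.2) G :=
    (MvPolynomial.continuous_eval G).comp hptc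
  have hsplit : ∀ z : V → ℝ, ∑ i ∈ A, z i ^ 2 = ∑ i ∈ A \ U, z i ^ 2 + ∑ i ∈ U, z i ^ 2 :=
    fun z => (Finset.sum_sdiff hUA).symm
  have hslice : ∀ y, ContinuousOn (fun v => eval (pt y v) G) K := fun y =>
    (hevalc.comp (Continuous.prodMk_right y)).continuousOn
  refine ⟨fun y => sInf ((fun v => eval (pt y v) G) '' K), hKcompact.continuous_sInf hevalc,
    ?_, ?_, ?_⟩
  · intro y y' hy
    have hrr : r y = r y' := by
      simp only [hr]
      rw [Finset.sum_congr rfl fun i hi => by rw [hy i hi]]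
    have : ∀ v, eval (pt y v) G = eval (pt y' v) G := fun v =>
      eval_congr_of_mem_supported hG fun i hi => by
        simp only [hpt, hrr]
        split_ifs with h1 h2
        · exact hy i h1
        · rfl
        · exact absurd hi h2
    simp only [this]
  · intro z hz
    obtain ⟨v, hv, hzv⟩ : ∃ v ∈ K, ∀ i ∈ A, pt z v i = z i := by
      have hr2 : r z ^ 2 = ∑ i ∈ A \ U, z i ^ 2 := by
        have h0 : 0 ≤ ∑ i ∈ A \ U, z i ^ 2 := Finset.sum_nonneg fun i _ => sq_nonneg _
        simp only [hr]
        rw [Real.sq_sqrt] <;> linarith [hsplit z]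
      by_cases h0 : r z = 0
      · refine ⟨_, hwK, fun i hi => ?_⟩
        simp only [hpt, h0, if_pos hi, zero_mul, ite_eq_left_iff]
        intro hiU
        rw [h0, zero_pow two_ne_zero, eq_comm,
          Finset.sum_eq_zero_iff_of_nonneg fun i _ => sq_nonneg _] at hr2
        exact (pow_eq_zero_iff two_ne_zero).1 (hr2 i (Finset.mem_sdiff.2 ⟨hi, hiU⟩)) |>.symm
      · refine ⟨fun i => if i ∈ A \ U then z i / r z else 0, ⟨fun i hi => if_neg hi, ?_⟩, ?_⟩
        · calc ∑ i ∈ A \ U, (if i ∈ A \ U then z i / r z else 0) ^ 2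
              = ∑ i ∈ A \ U, z i ^ 2 / r z ^ 2 :=
                Finset.sum_congr rfl fun i hi => by rw [if_pos hi, div_pow]
            _ = 1 := by rw [← Finset.sum_div, ← hr2, div_self (pow_ne_zero 2 h0)]
        · intro i hi
          by_cases hiU : i ∈ U
          · simp [hpt, hiU]
          · simp only [hpt, hiU, hi, if_false, if_true, Finset.mem_sdiff, not_false_eq_true,
              and_self]
            field_simp
    rw [← eval_congr_of_mem_supported hG hzv]
    exact csInf_le (hKcompact.image_of_continuousOn (hslice z)).bddBelow ⟨v, hv, rfl⟩
  · intro y hy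
    obtain ⟨v, hv, hmin, -⟩ := hKcompact.exists_sInf_image_eq_and_le ⟨_, hwK⟩ (hslice y)
    refine ⟨pt y v, fun i hi => by simp [hpt, hi], fun i hi => ?_, ?_, hmin.symm⟩
    · simp [hpt, hi]
    · have h1 : ∑ i ∈ U, pt y v i ^ 2 = ∑ i ∈ U, y i ^ 2 :=
        Finset.sum_congr rfl fun i hi => by simp [hpt, hi]
      have h2 : ∑ i ∈ A \ U, pt y v i ^ 2 = r y ^ 2 := by
        rw [← mul_one (r y ^ 2), ← hv.2, Finset.mul_sum]
        refine Finset.sum_congr rfl fun i hi => ?_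
        rw [Finset.mem_sdiff] at hi
        simp [hpt, hi.1, hi.2, mul_pow]
      rw [hsplit, h1, h2]
      simp only [hr]
      rw [Real.sq_sqrt (by linarith)]
      ring

/-- Weierstrass approximation on the cube by polynomials in a prescribed set of variables. -/
theorem exists_mem_supported_near [Fintype V] [DecidableEq V] {U : Finset V}
    {h : (V → ℝ) → ℝ} (hc : Continuous h) (hU : ∀ y y', (∀ i ∈ U, y i = y' i) → h y = h y')
    {δ : ℝ} (hδ : 0 < δ) :
    ∃ φ ∈ supported ℝ (U : Set V), ∀ z : V → ℝ, (∀ i, |z i| ≤ 1) → |eval z φ - h z| < δ := by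
  let ext : (U → ℝ) → V → ℝ := fun y i => if hi : i ∈ U then y ⟨i, hi⟩ else 0
  have hext : Continuous ext := by
    refine continuous_pi fun i => ?_
    by_cases hi : i ∈ U
    · simp only [ext, dif_pos hi]; fun_prop
    · simp only [ext, dif_neg hi]; fun_prop
  let toFun : MvPolynomial U ℝ →ₐ[ℝ] C(U → ℝ, ℝ) :=
    aeval fun i => ⟨fun y => y i, continuous_apply i⟩
  have htoFun : ∀ q y, toFun q y = eval y q := by
    intro q y
    induction q using MvPolynomial.induction_on with
    | C r => simp [toFun]
    | add p q hp hq => simp_all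
    | mul_X p i hp => simp_all [toFun]
  have hsep : toFun.range.SeparatesPoints := by
    intro x y hxy
    obtain ⟨i, hi⟩ := Function.ne_iff.1 hxy
    refine ⟨toFun (X i), ⟨toFun (X i), ⟨X i, rfl⟩, rfl⟩, ?_⟩
    simpa [toFun] using hi
  obtain ⟨_, ⟨q, rfl⟩, hq⟩ :=
    ContinuousMap.exists_mem_subalgebra_near_continuous_of_isCompact_of_separatesPoints hsep
      ⟨fun y => h (ext y), hc.comp hext⟩ (isCompact_cube (V := U)) hδ
  refine ⟨rename Subtype.val q, ?_, fun z hz => ?_⟩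
  · rw [supported_eq_range_rename]
    exact ⟨q, rfl⟩
  · have := hq (fun i => z i) fun i => hz i
    rw [Real.norm_eq_abs] at this
    convert this using 3
    · rw [eval_rename]
      exact (htoFun q _).symm
    · exact hU _ _ fun i hi => by simp [ext, hi]

/-- Under the running intersection property, a sum of polynomials in the variables of the cliques
that is positive on the common spheres can be rewritten with summands positive on each sphere. -/
theorem exists_positive_splitting [Fintype V] [DecidableEq V] (A : ℕ → Finset V) (k : ℕ)
    (hRIP : ∀ l < k, ∃ s ≤ l, ∀ i ∈ A (l + 1), ∀ j ≤ l, i ∈ A j → i ∈ A s)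
    (hpriv : ∀ l < k, ∃ w ∈ A (l + 1), ∀ j ≤ l, w ∉ A j)
    (G : ℕ → MvPolynomial V ℝ) (hG : ∀ l ≤ k, G l ∈ supported ℝ (A l : Set V))
    (hpos : ∀ z : V → ℝ, (∀ i, |z i| ≤ 1) → (∀ l ≤ k, ∑ i ∈ A l, z i ^ 2 = 1) →
      0 < ∑ l ∈ Finset.range (k + 1), eval z (G l)) :
    ∃ g : ℕ → MvPolynomial V ℝ, (∀ l ≤ k, g l ∈ supported ℝ (A l : Set V)) ∧
      ∑ l ∈ Finset.range (k + 1), g l = ∑ l ∈ Finset.range (k + 1), G l ∧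
      ∀ l ≤ k, ∀ z : V → ℝ, (∀ i, |z i| ≤ 1) → ∑ i ∈ A l, z i ^ 2 = 1 → 0 < eval z (g l) := by
  induction k generalizing G with
  | zero =>
    refine ⟨G, hG, rfl, fun l hl z hz hs => ?_⟩
    obtain rfl : l = 0 := by omega
    simpa using hpos z hz fun l hl => by
      obtain rfl : l = 0 := by omega
      exact hs
  | succ k ih =>
    obtain ⟨s, hsk, hs⟩ := hRIP k (Nat.lt_succ_self k)
    obtain ⟨w, hwA, hw⟩ := hpriv k (Nat.lt_succ_self k)
    set U : Finset V := (A (k + 1)).filter fun i => ∃ j ≤ k, i ∈ A j with hUdef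
    have hUA : U ⊆ A (k + 1) := Finset.filter_subset _ _
    have hUs : U ⊆ A s := fun i hi => by
      obtain ⟨h1, j, hj, h2⟩ := Finset.mem_filter.1 hi
      exact hs i h1 j hj h2
    have hwU : w ∉ U := fun h => by
      obtain ⟨-, j, hj, h2⟩ := Finset.mem_filter.1 h
      exact hw j hj h2
    obtain ⟨h, hc, hdep, hle, hatt⟩ :=
      exists_continuous_fiber_min hUA hwA hwU (hG (k + 1) le_rfl)
    set K : Set (V → ℝ) :=
      {z | (∀ i, |z i| ≤ 1) ∧ ∀ l ≤ k, ∑ i ∈ A l, z i ^ 2 = 1} with hK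
    have hKcompact : IsCompact K := by
      refine isCompact_cube.inter_right (t := {z | ∀ l ≤ k, ∑ i ∈ A l, z i ^ 2 = 1}) ?_
      simp only [Set.ofPred_forall]
      exact isClosed_iInter fun l => isClosed_iInter fun _ =>
        isClosed_eq (by fun_prop) continuous_const
    have hΦpos : ∀ z ∈ K, 0 < ∑ l ∈ Finset.range (k + 1), eval z (G l) + h z := by
      rintro z ⟨hz1, hz2⟩
      obtain ⟨u, huU, huA, hu1, hu2⟩ := hatt z (by
        rw [← hz2 s hsk]
        exact Finset.sum_le_sum_of_subset_of_nonneg hUs fun i _ _ => sq_nonneg _)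
      have hagree : ∀ l ≤ k, ∀ i ∈ A l, u i = z i := by
        intro l hl i hi
        by_cases hiA : i ∈ A (k + 1)
        · exact huU i (Finset.mem_filter.2 ⟨hiA, l, hl, hi⟩)
        · exact huA i hiA
      have hp := hpos u (fun i => by
        by_cases hi : i ∈ A (k + 1)
        · exact abs_le_one_of_sum_sq_eq_one hu1 hi
        · rw [huA i hi]; exact hz1 i) (fun l hl => by
        rcases Nat.le_succ_iff.1 hl with hl | rfl
        · rw [← hz2 l hl]
          exact Finset.sum_congr rfl fun i hi => by rw [hagree l hl i hi]
        · exact hu1)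
      rw [Finset.sum_range_succ, hu2] at hp
      convert hp using 2
      refine Finset.sum_congr rfl fun l hl => ?_
      have hl : l ≤ k := Nat.lt_succ_iff.1 (Finset.mem_range.1 hl)
      exact eval_congr_of_mem_supported (hG l (hl.trans (Nat.le_succ k)))
        fun i hi => (hagree l hl i hi).symm
    obtain ⟨δ, hδ, hδK⟩ : ∃ δ > 0, ∀ z ∈ K,
        δ ≤ ∑ l ∈ Finset.range (k + 1), eval z (G l) + h z := by
      refine hKcompact.exists_forall_le' (ContinuousOn.add ?_ hc.continuousOn) hΦpos
      exact continuousOn_finsetSum _ fun l _ => (MvPolynomial.continuous_eval _).continuousOn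
    obtain ⟨φ, hφU, hφ⟩ := exists_mem_supported_near
      (h := fun z => h z - δ / 2) (by fun_prop) (fun y y' hy => by rw [hdep y y' hy])
      (half_pos hδ)
    have hsmem : s ∈ Finset.range (k + 1) := Finset.mem_range.2 (Nat.lt_succ_of_le hsk)
    have hsum : ∑ l ∈ Finset.range (k + 1), Function.update G s (G s + φ) l
        = ∑ l ∈ Finset.range (k + 1), G l + φ := by
      rw [← Finset.add_sum_erase _ _ hsmem, ← Finset.add_sum_erase _ G hsmem,
        Function.update_self,
        Finset.sum_congr rfl fun l hl => Function.update_of_ne (Finset.ne_of_mem_erase hl) _ _]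
      abel
    obtain ⟨g, hg1, hg2, hg3⟩ := ih (fun l hl => hRIP l (hl.trans (Nat.lt_succ_self k)))
      (fun l hl => hpriv l (hl.trans (Nat.lt_succ_self k))) (Function.update G s (G s + φ))
      (by
        intro l hl
        by_cases hls : l = s
        · subst hls
          rw [Function.update_self]
          exact add_mem (hG l (hl.trans (Nat.le_succ k)))
            (supported_mono (by exact_mod_cast hUs) hφU)
        · rw [Function.update_of_ne hls]
          exact hG l (hl.trans (Nat.le_succ k)))
      (by
        intro z hz1 hz2
        rw [← map_sum, hsum, map_add, map_sum]
        have h1 := hδK z ⟨hz1, hz2⟩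
        have h2 := (abs_lt.1 (hφ z hz1)).1
        linarith)
    refine ⟨Function.update g (k + 1) (G (k + 1) - φ), ?_, ?_, ?_⟩
    · intro l hl
      rcases Nat.le_succ_iff.1 hl with hl | rfl
      · rw [Function.update_of_ne (by omega)]
        exact hg1 l hl
      · rw [Function.update_self]
        exact sub_mem (hG _ le_rfl) (supported_mono (by exact_mod_cast hUA) hφU)
    · rw [Finset.sum_range_succ, Finset.sum_range_succ _ (k + 1), Function.update_self,
        Finset.sum_congr rfl fun l hl => by
          rw [Function.update_of_ne (Finset.mem_range.1 hl).ne], hg2, hsum]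
      abel
    · intro l hl z hz1 hz2
      rcases Nat.le_succ_iff.1 hl with hl | rfl
      · rw [Function.update_of_ne (by omega)]
        exact hg3 l hl z hz1 hz2
      · rw [Function.update_self, map_sub]
        have h1 := hle z hz2
        have h2 := (abs_lt.1 (hφ z hz1)).2
        linarith

end Splitting

section Homogenization

variable {n d : ℕ}

theorem MvPolynomial.IsHomogeneous.eval_smul_eq {ι : Type*} {F : MvPolynomial ι ℝ}
    (hF : F.IsHomogeneous d) (c : ℝ) (x : ι → ℝ) : eval (c • x) F = c ^ d * eval x F := by
  rw [eval_eq, eval_eq, Finset.mul_sum]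
  refine Finset.sum_congr rfl fun m hm => ?_
  have hdeg : ∑ i ∈ m.support, m i = d := by
    rw [← hF (mem_support_iff.1 hm), ← Finsupp.degree_apply, Finsupp.degree_eq_weight_one]
    rfl
  simp only [Pi.smul_apply, smul_eq_mul, mul_pow, Finset.prod_mul_distrib,
    Finset.prod_pow_eq_pow_sum, hdeg]
  ring

/-- The homogenization in degree `d` of the part of degree at most `d` of a polynomial. -/
noncomputable def homogenizeTo (d : ℕ) :
    MvPolynomial (Fin n) ℝ →ₗ[ℝ] MvPolynomial (Fin (n + 1)) ℝ :=
  ∑ j ∈ Finset.range (d + 1), LinearMap.mulLeft ℝ (X 0 ^ (d - j)) ∘ₗ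
    (rename Fin.succ).toLinearMap ∘ₗ homogeneousComponent j

theorem homogenizeTo_apply (q : MvPolynomial (Fin n) ℝ) :
    homogenizeTo d q = ∑ j ∈ Finset.range (d + 1),
      X 0 ^ (d - j) * rename Fin.succ (homogeneousComponent j q) := by
  simp [homogenizeTo, LinearMap.sum_apply]

theorem homogenizeTo_isHomogeneous (q : MvPolynomial (Fin n) ℝ) :
    (homogenizeTo d q).IsHomogeneous d := by
  rw [homogenizeTo_apply]
  refine IsHomogeneous.sum _ _ _ fun j hj => ?_
  have hjd : j ≤ d := Nat.lt_succ_iff.1 (Finset.mem_range.1 hj)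
  have := ((isHomogeneous_X ℝ (0 : Fin (n + 1))).pow (d - j)).mul
    ((homogeneousComponent_isHomogeneous j q).rename_isHomogeneous (f := Fin.succ))
  convert this using 1
  omega

theorem eval_cons_one_homogenizeTo {q : MvPolynomial (Fin n) ℝ} (hq : q.totalDegree ≤ d)
    (x : Fin n → ℝ) : eval (Fin.cons 1 x) (homogenizeTo d q) = eval x q := by
  conv_rhs => rw [← sum_homogeneousComponent q, map_sum]
  rw [homogenizeTo_apply, map_sum]
  rw [Finset.sum_subset (Finset.range_subset_range.2 (Nat.succ_le_succ hq)) fun j _ hj => by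
    rw [homogeneousComponent_eq_zero j q (by simpa using hj), map_zero]]
  exact Finset.sum_congr rfl fun j _ => by simp [eval_rename, Function.comp_def]

theorem rename_homogenizeTo_mem_supported {τ : Type*} (d : ℕ) {q : MvPolynomial (Fin n) ℝ}
    {J : Finset (Fin n)} (hq : q.vars ⊆ J) (φ : Fin (n + 1) → τ) {s : Set τ} (h0 : φ 0 ∈ s)
    (hs : ∀ i ∈ J, φ i.succ ∈ s) : rename φ (homogenizeTo d q) ∈ supported ℝ s := by
  classical
  rw [homogenizeTo_apply, map_sum]
  refine sum_mem fun j _ => ?_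
  rw [map_mul, map_pow, rename_X, rename_rename]
  refine mul_mem (pow_mem (X_mem_supported.2 h0) _) (mem_supported.2 fun t ht => ?_)
  obtain ⟨i, hi, rfl⟩ := Finset.mem_image.1 (vars_rename _ _ ht)
  refine hs i (hq ?_)
  obtain ⟨m, hm, him⟩ := (mem_vars_iff_mem_support _).1 hi
  rw [support_homogeneousComponent] at hm
  exact (mem_vars_iff_mem_support _).2 ⟨m, (Finset.mem_filter.1 hm).1, him⟩

theorem eq_smul_cons_one {x : Fin (n + 1) → ℝ} (h0 : x 0 ≠ 0) :
    x = x 0 • (Fin.cons 1 fun i => x i.succ / x 0 : Fin (n + 1) → ℝ) := by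
  ext i
  refine Fin.cases ?_ (fun i => ?_) i
  · simp
  · simp [mul_div_cancel₀ _ h0]

/-- A homogeneous polynomial of degree `d` that dehomogenizes to `f` is its homogenization. -/
theorem eq_homogenizeTo {f : MvPolynomial (Fin n) ℝ} (hd : f.totalDegree ≤ d)
    {F : MvPolynomial (Fin (n + 1)) ℝ} (hF : F.IsHomogeneous d)
    (hdeh : ∀ x : Fin n → ℝ, eval (Fin.cons 1 x) F = eval x f) : F = homogenizeTo d f := by
  refine mul_left_cancel₀ (X_ne_zero (R := ℝ) (0 : Fin (n + 1))) (MvPolynomial.funext fun x => ?_)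
  rw [map_mul, map_mul, eval_X]
  by_cases h0 : x 0 = 0
  · rw [h0, zero_mul, zero_mul]
  · rw [eq_smul_cons_one h0, hF.eval_smul_eq, (homogenizeTo_isHomogeneous f).eval_smul_eq, hdeh,
      eval_cons_one_homogenizeTo hd]

theorem even_of_pos_at_infinity (hn : 1 ≤ n) {F : MvPolynomial (Fin (n + 1)) ℝ}
    (hF : F.IsHomogeneous d) (hinf : ∀ x : Fin n → ℝ, x ≠ 0 → 0 < eval (Fin.cons 0 x) F) :
    Even d := by
  by_contra hodd
  rw [Nat.not_even_iff_odd] at hodd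
  have : Nonempty (Fin n) := ⟨⟨0, hn⟩⟩
  have h1 := hinf 1 one_ne_zero
  have h2 := hinf (-1) (neg_ne_zero.2 one_ne_zero)
  have he : (Fin.cons 0 (-1 : Fin n → ℝ) : Fin (n + 1) → ℝ)
      = (-1 : ℝ) • (Fin.cons 0 (1 : Fin n → ℝ) : Fin (n + 1) → ℝ) := by
    ext i
    refine Fin.cases ?_ (fun i => ?_) i <;> simp
  rw [he, hF.eval_smul_eq, hodd.neg_one_pow] at h2
  linarith

theorem homogenization_pos (heven : Even d) {F : MvPolynomial (Fin (n + 1)) ℝ}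
    (hF : F.IsHomogeneous d) {f : MvPolynomial (Fin n) ℝ}
    (hdeh : ∀ x : Fin n → ℝ, eval (Fin.cons 1 x) F = eval x f)
    (hpos : ∀ x : Fin n → ℝ, 0 < eval x f)
    (hinf : ∀ x : Fin n → ℝ, x ≠ 0 → 0 < eval (Fin.cons 0 x) F)
    {x : Fin (n + 1) → ℝ} (hx : x ≠ 0) : 0 < eval x F := by
  by_cases h0 : x 0 = 0
  · have h := hinf (Fin.tail x) fun h => hx (by
      rw [← Fin.cons_self_tail x, h, h0]
      ext i
      refine Fin.cases ?_ (fun i => ?_) i <;> simp)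
    have he : (Fin.cons 0 (Fin.tail x) : Fin (n + 1) → ℝ) = x := by
      rw [← h0]
      exact Fin.cons_self_tail x
    rwa [he] at h
  · rw [eq_smul_cons_one h0, hF.eval_smul_eq, hdeh]
    exact mul_pos (heven.pow_pos h0) (hpos _)

end Homogenization

/-- Let `f` be a real polynomial in `x_1,…,x_n` of degree `d` with
`f > 0` on `ℝⁿ`, whose highest-degree homogeneous part `f^(∞)(x) = f̃(0,x)` is positive
definite, admitting a csp `(x(1),…,x(p))` satisfying the RIP. Then for every
`ε > 0` there exist, for each `ℓ`, an SOS `σ_ℓ ∈ Σ[{x₀}∪x(ℓ)∪{w_ℓ}]` and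
`τ_ℓ ∈ ℝ[{x₀}∪x(ℓ)∪{w_ℓ}]` with
`f̃ + ε·Σ_ℓ w_ℓ^d = Σ_ℓ (σ_ℓ + τ_ℓ·(x₀² + Σ_{x_i∈x(ℓ)} x_i² + w_ℓ² − 1))`. -/
theorem stmt_10
    (n p : ℕ) (hn : 1 ≤ n) (hp : 1 ≤ p)
    (f : MvPolynomial (Fin n) ℝ)
    (d : ℕ) (hd : d = f.totalDegree)
    (hfpos : ∀ x : Fin n → ℝ, 0 < eval x f)
    -- homogenization of f
    (F : MvPolynomial (Fin (n + 1)) ℝ)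
    (hFhom : F.IsHomogeneous d)
    (hFdeh : ∀ x : Fin n → ℝ, eval (Fin.cons 1 x) F = eval x f)
    -- the highest-degree homogeneous part f^(∞)(x) = f̃(0,x) is positive definite
    (hFinf : ∀ x : Fin n → ℝ, x ≠ 0 → 0 < eval (Fin.cons 0 x) F)
    -- correlative sparsity pattern satisfying the RIP
    (I : Fin p → Finset (Fin n)) (hI : ∀ i : Fin n, ∃ ℓ : Fin p, i ∈ I ℓ)
    (fdec : Fin p → MvPolynomial (Fin n) ℝ)
    (hfdec : f = ∑ ℓ, fdec ℓ) (hfvars : ∀ ℓ, (fdec ℓ).vars ⊆ I ℓ)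
    (hRIP : ∀ (ℓ : Fin p) (h : (ℓ : ℕ) + 1 < p), ∃ s : Fin p, s ≤ ℓ ∧
      I ⟨(ℓ : ℕ) + 1, h⟩ ∩ (Finset.Iic ℓ).biUnion I ⊆ I s)
    -- variable cliques of the lifted problem
    (A : Fin p → Finset (Fin (n + 1) ⊕ Fin p))
    (hA : ∀ ℓ, A ℓ = insert (Sum.inl 0) (insert (Sum.inr ℓ)
      ((I ℓ).image fun i => Sum.inl i.succ)))
    (ε : ℝ) (hε : 0 < ε) :
    ∃ (σ τ : Fin p → MvPolynomial (Fin (n + 1) ⊕ Fin p) ℝ),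
      (∀ ℓ, IsSOSOn (A ℓ) (σ ℓ)) ∧
      (∀ ℓ, (τ ℓ).vars ⊆ A ℓ) ∧
      rename Sum.inl F
        + C ε * (∑ ℓ, (X (Sum.inr ℓ)) ^ d)
      = ∑ ℓ, (σ ℓ + τ ℓ * ((X (Sum.inl 0)) ^ 2 + (∑ i ∈ I ℓ, (X (Sum.inl i.succ)) ^ 2)
          + (X (Sum.inr ℓ)) ^ 2 - 1)) := by
  obtain ⟨k, rfl⟩ : ∃ k, p = k + 1 := ⟨p - 1, by omega⟩
  have hmemA : ∀ ℓ i, i ∈ A ℓ ↔ i = Sum.inl 0 ∨ i = Sum.inr ℓ ∨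
      ∃ m ∈ I ℓ, Sum.inl m.succ = i := fun ℓ i => by rw [hA]; simp
  have hsumA : ∀ {M : Type} [AddCommMonoid M] (ℓ : Fin (k + 1))
      (φ : Fin (n + 1) ⊕ Fin (k + 1) → M),
      ∑ i ∈ A ℓ, φ i = φ (Sum.inl 0) + (∑ i ∈ I ℓ, φ (Sum.inl i.succ)) + φ (Sum.inr ℓ) := by
    intro M _ ℓ φ
    rw [hA, Finset.sum_insert, Finset.sum_insert, Finset.sum_image, add_assoc,
      add_comm (φ (Sum.inr ℓ))]
    · intro i _ j _ hij
      simpa using hij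
    · simp
    · simp [Fin.succ_ne_zero]
  have hFeq : F = ∑ ℓ, homogenizeTo d (fdec ℓ) := by
    rw [← map_sum, ← hfdec]
    exact eq_homogenizeTo hd.ge hFhom hFdeh
  have heven : Even d := even_of_pos_at_infinity hn hFhom hFinf
  let idx : ℕ → Fin (k + 1) := fun l => ⟨min l k, by omega⟩
  have hidx : ∀ ℓ : Fin (k + 1), idx ℓ = ℓ := fun ℓ => Fin.ext (by simp [idx]; omega)
  have hidx_val : ∀ l ≤ k, (idx l : ℕ) = l := fun l hl => by simp [idx, hl]
  let G : Fin (k + 1) → MvPolynomial (Fin (n + 1) ⊕ Fin (k + 1)) ℝ := fun ℓ =>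
    rename Sum.inl (homogenizeTo d (fdec ℓ)) + C ε * X (Sum.inr ℓ) ^ d
  have hGsum : rename Sum.inl F + C ε * (∑ ℓ, (X (Sum.inr ℓ)) ^ d) = ∑ ℓ, G ℓ := by
    simp only [G, Finset.sum_add_distrib, ← Finset.mul_sum, hFeq, map_sum]
  obtain ⟨g, hg1, hg2, hg3⟩ := exists_positive_splitting (fun l => A (idx l)) k
    (by
      intro l hl
      obtain ⟨s, hsl, hs⟩ := hRIP ⟨l, by omega⟩ (by simpa using hl)
      have hsl' : (s : ℕ) ≤ l := hsl
      refine ⟨s, hsl', fun i hi j hj hij => ?_⟩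
      simp only [hidx] at hi hij ⊢
      rw [hmemA] at hi hij ⊢
      rcases hi with rfl | rfl | ⟨m, hm, rfl⟩
      · simp
      · have h := hij
        simp only [reduceCtorEq, false_or, Sum.inr.injEq, and_false, exists_false, or_false] at h
        have h' := congrArg Fin.val h
        rw [hidx_val _ hl, hidx_val _ (hj.trans hl.le)] at h'
        omega
      · refine Or.inr (Or.inr ⟨m, hs (Finset.mem_inter.2 ⟨?_, ?_⟩), rfl⟩)
        · convert hm using 2
          exact Fin.ext (hidx_val _ hl).symm
        · have hmj : m ∈ I (idx j) := by simpa [Fin.succ_ne_zero] using hij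
          refine Finset.mem_biUnion.2 ⟨idx j, Finset.mem_Iic.2 ?_, hmj⟩
          rw [Fin.le_def, hidx_val _ (hj.trans hl.le)]
          exact hj)
    (by
      intro l hl
      refine ⟨Sum.inr (idx (l + 1)), (hmemA _ _).2 (by simp), fun j hj h => ?_⟩
      rw [hmemA] at h
      simp only [reduceCtorEq, false_or, Sum.inr.injEq, and_false, exists_false, or_false] at h
      have h' := congrArg Fin.val h
      rw [hidx_val _ hl, hidx_val _ (hj.trans hl.le)] at h'
      omega)
    (fun l => G (idx l))
    (by
      intro l _
      refine add_mem ?_ (mul_mem (Subalgebra.algebraMap_mem _ ε) (pow_mem ?_ d))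
      · refine rename_homogenizeTo_mem_supported d (hfvars _) _ ?_ fun i hi => ?_
        · exact Finset.mem_coe.2 ((hmemA _ _).2 (by simp))
        · exact Finset.mem_coe.2 ((hmemA _ _).2 (Or.inr (Or.inr ⟨i, hi, rfl⟩)))
      · exact X_mem_supported.2 (Finset.mem_coe.2 ((hmemA _ _).2 (by simp))))
    (by
      intro z _ hz
      have hz0 : z (Sum.inl 0) ^ 2 + (∑ i ∈ I 0, z (Sum.inl i.succ) ^ 2)
          + z (Sum.inr 0) ^ 2 = 1 := by
        rw [← hsumA 0 fun i => z i ^ 2]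
        exact hz 0 (Nat.zero_le k)
      rw [Finset.sum_range, ← map_sum]
      simp only [hidx]
      rw [← hGsum]
      simp only [map_add, map_mul, map_sum, map_pow, eval_C, eval_X, eval_rename]
      have hw : ∀ ℓ, 0 ≤ z (Sum.inr ℓ) ^ d := fun ℓ => heven.pow_nonneg _
      by_cases h0 : z ∘ Sum.inl = 0
      · have hzero : ∀ i, z (Sum.inl i) = 0 := fun i => congrFun h0 i
        have hz0' : z (Sum.inr 0) ≠ 0 := by
          intro h
          simp [hzero, h] at hz0
        have h1 : 0 < ∑ ℓ, z (Sum.inr ℓ) ^ d :=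
          Finset.sum_pos' (fun ℓ _ => hw ℓ) ⟨0, Finset.mem_univ _, heven.pow_pos hz0'⟩
        have h2 : 0 ≤ eval (z ∘ Sum.inl) F := by
          rw [h0, ← zero_smul ℝ (Fin.cons 1 (0 : Fin n → ℝ) : Fin (n + 1) → ℝ),
            hFhom.eval_smul_eq, hFdeh]
          exact mul_nonneg (heven.pow_nonneg _) (hfpos _).le
        have := mul_pos hε h1
        linarith
      · have h1 := homogenization_pos heven hFhom hFdeh hfpos hFinf h0
        have := mul_nonneg hε.le (Finset.sum_nonneg fun ℓ (_ : ℓ ∈ Finset.univ) => hw ℓ)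
        linarith)
  have hrepr : ∀ ℓ : Fin (k + 1), ∃ s τ, IsSOSOn (A ℓ) s ∧ τ.vars ⊆ A ℓ ∧
      g ℓ = s + τ * (∑ i ∈ A ℓ, X i ^ 2 - 1) := by
    intro ℓ
    have hℓ : (ℓ : ℕ) ≤ k := Nat.lt_succ_iff.1 ℓ.isLt
    have hmem := hg1 ℓ hℓ
    have hp := hg3 ℓ hℓ
    rw [hidx] at hmem
    simp only [hidx] at hp
    refine exists_isSOSOn_of_pos_on_sphere (A ℓ) (g ℓ) hmem fun z hz hz1 => hp z (fun i => ?_) hz1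
    by_cases hi : i ∈ A ℓ
    · exact abs_le_one_of_sum_sq_eq_one hz1 hi
    · simp [hz i hi]
  choose σ τ hσ hτ hrep using hrepr
  refine ⟨σ, τ, hσ, hτ, ?_⟩
  rw [Finset.sum_range, Finset.sum_range] at hg2
  simp only [hidx] at hg2
  rw [hGsum, ← hg2]
  refine Finset.sum_congr rfl fun ℓ _ => ?_
  rw [hrep, hsumA]
end

section
/- Suppose d = deg f ≥ 1 and f is positive at infinity on K, i.e., f^(∞)(x) > 0 for all x ∈ K^(∞). Then for every γ ∈ ℝ with γ < f_min and every (x̃, w) ∈ K̃_s², one has f̃(x̃) − γ x_0^d > 0. -/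
open MvPolynomial

theorem MvPolynomial.IsHomogeneous.eval_const_mul {σ R : Type*} [CommSemiring R]
    {P : MvPolynomial σ R} {d : ℕ} (hP : P.IsHomogeneous d) (c : R) (x : σ → R) :
    eval (fun i => c * x i) P = c ^ d * eval x P := by
  rw [eval_eq, eval_eq, Finset.mul_sum]
  refine Finset.sum_congr rfl fun s hs => ?_
  have hdeg : ∑ i ∈ s.support, s i = d := by
    rw [← hP (mem_support_iff.mp hs), Finsupp.weight_apply, Finsupp.sum]
    simp
  simp_rw [mul_pow]
  rw [Finset.prod_mul_distrib, Finset.prod_pow_eq_pow_sum, hdeg]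
  ring

/-- Summing over the blocks of a cover, with each term divided by the number of blocks
containing its index, recovers the full sum. -/
theorem sum_sum_div_card_filter_mem {ι κ : Type*} [Fintype ι] [Fintype κ] [DecidableEq ι]
    (I : κ → Finset ι) (hI : ∀ i, ∃ l, i ∈ I l) (a : ι → ℝ) :
    ∑ l, ∑ i ∈ I l, a i / ((Finset.univ.filter fun l => i ∈ I l).card : ℝ) = ∑ i, a i := by
  rw [Finset.sum_comm' (t' := Finset.univ) (s' := fun i => Finset.univ.filter fun l => i ∈ I l)
    (by simp)]
  refine Finset.sum_congr rfl fun i _ => ?_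
  have hpos : 0 < (Finset.univ.filter fun l => i ∈ I l).card :=
    Finset.card_pos.mpr ((hI i).imp fun l hl => by simpa using hl)
  rw [Finset.sum_const, nsmul_eq_mul, mul_div_cancel₀ _ (Nat.cast_ne_zero.mpr hpos.ne')]

/-- Suppose `d = deg f ≥ 1` and `f` is positive at infinity on `K`,
i.e. `f^(∞)(x) > 0` for all `x ∈ K^(∞)`. Then for every `γ < f_min` and every
`(x̃, w) ∈ K̃ₛ²`, one has `f̃(x̃) − γ x₀^d > 0`. -/
theorem stmt_15
    (n m p : ℕ) (hn : 1 ≤ n) (hm : 1 ≤ m) (hp : 1 ≤ p)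
    (f : MvPolynomial (Fin n) ℝ) (g : Fin m → MvPolynomial (Fin n) ℝ)
    (I : Fin p → Finset (Fin n)) (hI : ∀ i : Fin n, ∃ ℓ : Fin p, i ∈ I ℓ)
    -- p_i: frequency of the variable x_i among the cliques
    (pc : Fin n → ℕ) (hpc : ∀ i, pc i = (Finset.univ.filter fun ℓ => i ∈ I ℓ).card)
    (K : Set (Fin n → ℝ)) (hK : K = {x | ∀ j, 0 ≤ eval x (g j)})
    (hKne : K.Nonempty)
    (d : ℕ) (hd : d = f.totalDegree) (hd1 : 1 ≤ d)
    -- homogenizations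
    (F : MvPolynomial (Fin (n + 1)) ℝ)
    (hFhom : F.IsHomogeneous d)
    (hFdeh : ∀ x : Fin n → ℝ, eval (Fin.cons 1 x) F = eval x f)
    (G : Fin m → MvPolynomial (Fin (n + 1)) ℝ)
    (hGhom : ∀ j, (G j).IsHomogeneous (g j).totalDegree)
    (hGdeh : ∀ j, ∀ x : Fin n → ℝ, eval (Fin.cons 1 x) (G j) = eval x (g j))
    -- f_min: the (finite) infimum of f on K
    (fmin : ℝ) (hfmin : IsGLB ((fun x => eval x f) '' K) fmin)
    -- f is positive at infinity on K: f^(∞) > 0 on K^(∞)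
    (hfinf : ∀ x : Fin n → ℝ,
      (∀ j, 0 ≤ eval (Fin.cons 0 x) (G j)) → (∑ i, (x i) ^ 2 = 1) →
      0 < eval (Fin.cons 0 x) F)
    -- the sparse homogenized set K̃ₛ²
    (Ks : Set ((Fin (n + 1) → ℝ) × (Fin p → ℝ)))
    (hKs : Ks = {z | 0 ≤ z.1 0 ∧ (∀ j, 0 ≤ eval z.1 (G j)) ∧
      (∀ ℓ : Fin p, (∑ i ∈ I ℓ, (z.1 i.succ) ^ 2 / (pc i : ℝ))
        + (z.1 0) ^ 2 / (p : ℝ) + (z.2 ℓ) ^ 2 = 1) ∧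
      (∑ ℓ, (z.2 ℓ) ^ 2 = (p : ℝ) - 1) ∧
      (∀ i : Fin (n + 1), 0 ≤ 1 - (z.1 i) ^ 2) ∧
      (∀ ℓ : Fin p, 0 ≤ 1 - (z.2 ℓ) ^ 2)})
    (γ : ℝ) (hγ : γ < fmin) :
    ∀ z ∈ Ks, 0 < eval z.1 F - γ * (z.1 0) ^ d := by
  subst hK hKs
  rintro ⟨z, w⟩ ⟨h0, hG, hsum, hw, -, -⟩
  dsimp only at *
  rcases h0.eq_or_lt with hz | hz
  · have hp0 : (p : ℝ) ≠ 0 := by exact_mod_cast (by omega : p ≠ 0)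
    have hzc : z = Fin.cons 0 (fun i => z i.succ) := by
      rw [hz]; exact (Fin.cons_self_tail z).symm
    have hnorm : ∑ i : Fin n, z i.succ ^ 2 = 1 := by
      have htot := Finset.sum_congr rfl fun l (_ : l ∈ Finset.univ) => hsum l
      simp_rw [hpc, ← hz] at htot
      rw [Finset.sum_add_distrib, Finset.sum_add_distrib, hw,
        sum_sum_div_card_filter_mem I hI fun i => z i.succ ^ 2] at htot
      simp at htot
      linarith
    have hpos := hfinf (fun i => z i.succ) (by rwa [← hzc]) hnorm
    rw [← hzc] at hpos
    rw [← hz, zero_pow (by omega)]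
    linarith
  · have hzc : z = fun i => z 0 * (Fin.cons 1 (fun i => z i.succ / z 0) : Fin (n + 1) → ℝ) i := by
      ext i
      refine Fin.cases ?_ (fun i => ?_) i
      · simp
      · simp [mul_div_cancel₀ _ hz.ne']
    have hy : ∀ j, 0 ≤ eval (fun i => z i.succ / z 0) (g j) := fun j => by
      have h := hG j
      rw [hzc, (hGhom j).eval_const_mul, hGdeh] at h
      exact nonneg_of_mul_nonneg_right h (pow_pos hz _)
    have hF : eval z F = z 0 ^ d * eval (fun i => z i.succ / z 0) f := by
      conv_lhs => rw [hzc]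
      rw [hFhom.eval_const_mul, hFdeh]
    have hf := hfmin.1 ⟨_, hy, rfl⟩
    dsimp only at hf
    rw [hF]
    nlinarith [mul_pos (pow_pos hz d) (show 0 < eval (fun i => z i.succ / z 0) f - γ by linarith)]
end

section
/- (i) The polynomial x_1²x_2⁴ − x_2⁴x_3² is unbounded below on ℝ³, i.e., inf_{(x_1,x_2,x_3)∈ℝ³} (x_1²x_2⁴ − x_2⁴x_3²) = −∞. (ii) Nevertheless, for every ε ≥ 0 and every (x_0,x_1,x_2,x_3) ∈ ℝ⁴ satisfying x_0² + x_1² + x_2² = 1 and x_0² + x_2² + x_3² = 1, one has x_1²x_2⁴ − x_2⁴x_3² + ε(x_0⁴ + x_1⁴ + x_2⁴) ≥ 0; consequently the optimal value of the sparse homogenized reformulation without auxiliary variables w is nonnegative for every ε ≥ 0, so it fails to equal the true infimum. -/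
/-- On the sparse sphere constraints `x₁² = x₃²`, so the perturbed objective is nonnegative. -/
theorem sparse_objective_nonneg {ε x0 x1 x2 x3 : ℝ} (hε : 0 ≤ ε)
    (h1 : x0 ^ 2 + x1 ^ 2 + x2 ^ 2 = 1) (h2 : x0 ^ 2 + x2 ^ 2 + x3 ^ 2 = 1) :
    0 ≤ x1 ^ 2 * x2 ^ 4 - x2 ^ 4 * x3 ^ 2 + ε * (x0 ^ 4 + x1 ^ 4 + x2 ^ 4) := by
  have h : x1 ^ 2 = x3 ^ 2 := by linarith
  have h0 : x1 ^ 2 * x2 ^ 4 - x2 ^ 4 * x3 ^ 2 = 0 := by rw [h]; ring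
  rw [h0]
  positivity

/-- (i) The polynomial `x₁²x₂⁴ − x₂⁴x₃²` is unbounded below on `ℝ³`.
(ii) Nevertheless, for every `ε ≥ 0` and every `(x₀,x₁,x₂,x₃) ∈ ℝ⁴` with
`x₀² + x₁² + x₂² = 1` and `x₀² + x₂² + x₃² = 1`, one has
`x₁²x₂⁴ − x₂⁴x₃² + ε(x₀⁴ + x₁⁴ + x₂⁴) ≥ 0`; consequently the optimal value of the
sparse homogenized reformulation without auxiliary variables `w` is nonnegative for
every `ε ≥ 0`, so it fails to equal the true infimum. -/
theorem stmt_18 :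
    (∀ c : ℝ, ∃ x1 x2 x3 : ℝ, x1 ^ 2 * x2 ^ 4 - x2 ^ 4 * x3 ^ 2 < c) ∧
    (∀ ε : ℝ, 0 ≤ ε → ∀ x0 x1 x2 x3 : ℝ,
      x0 ^ 2 + x1 ^ 2 + x2 ^ 2 = 1 → x0 ^ 2 + x2 ^ 2 + x3 ^ 2 = 1 →
      0 ≤ x1 ^ 2 * x2 ^ 4 - x2 ^ 4 * x3 ^ 2 + ε * (x0 ^ 4 + x1 ^ 4 + x2 ^ 4)) ∧
    (∀ ε : ℝ, 0 ≤ ε →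
      0 ≤ sSup {γ : ℝ | ∀ x0 x1 x2 x3 : ℝ,
        x0 ^ 2 + x1 ^ 2 + x2 ^ 2 = 1 → x0 ^ 2 + x2 ^ 2 + x3 ^ 2 = 1 →
        0 ≤ x1 ^ 2 * x2 ^ 4 - x2 ^ 4 * x3 ^ 2 + ε * (x0 ^ 4 + x1 ^ 4 + x2 ^ 4)
          - γ * x0 ^ 4}) := by
  refine ⟨fun c => ⟨0, 1, |c| + 1, ?_⟩,
    fun ε hε x0 x1 x2 x3 h1 h2 => sparse_objective_nonneg hε h1 h2, fun ε hε => ?_⟩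
  · nlinarith [abs_nonneg c, neg_abs_le c]
  · refine le_csSup ⟨ε, fun γ hγ => ?_⟩ fun x0 x1 x2 x3 h1 h2 => ?_
    · have := hγ 1 0 0 0 (by norm_num) (by norm_num)
      norm_num at this
      exact this
    · simpa using sparse_objective_nonneg hε h1 h2
end
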